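/- For every positive integer d there exists a constant C depending only on d such that the following holds. Let n be a positive integer and let 𝓕 ⊆ binom([n], d+1) be a family with VC-dimension at most d. Then there exist a subfamily 𝓖 ⊆ 𝓕 and an assignment c of maximum 𝓖-certificates of the sets in 𝓖 such that: (i) |𝓕 \ 𝓖| ≤ 0.1·|∂̄𝓕| + C·n^{d−2} and |𝓖| ≥ |𝓕| − 0.1·|∂̄𝓖| − C·n^{d−2}; (ii) d−1 ≤ |c(F)| ≤ d for every F ∈ 𝓖; (iii) if F, F′ ∈ 𝓖 with |c(F)| = |c(F′)| = d−1 and c(F) ≠ c(F′), then the families S_{F,c} = {S : c(F) ⊆ S ⊆ F and |S| ∈ {d−1, d}} and S_{F′,c} = {S : c(F′) ⊆ S ⊆ F′ and |S| ∈ {d−1, d}} are disjoint. -/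

import Mathlib

open Finset

/-- `S` is shattered by the family `𝓕`. -/
def Shatters' {n : ℕ} (𝓕 : Finset (Finset (Fin n))) (S : Finset (Fin n)) : Prop :=
  ∀ A ⊆ S, ∃ F ∈ 𝓕, F ∩ S = A

/-- The VC-dimension of `𝓕` is at most `d`. -/
def VCDimLE {n : ℕ} (𝓕 : Finset (Finset (Fin n))) (d : ℕ) : Prop :=
  ∀ S : Finset (Fin n), Shatters' 𝓕 S → S.card ≤ d

/-- `T` is a `𝓖`-certificate of `F`: a proper subset of `F` such that no member of `𝓖`
meets `F` exactly in `T`. -/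
def IsCert {n : ℕ} (𝓖 : Finset (Finset (Fin n))) (F T : Finset (Fin n)) : Prop :=
  T ⊂ F ∧ ∀ F' ∈ 𝓖, F' ∩ F ≠ T

/-- `c` assigns to each member of `𝓖` a maximum `𝓖`-certificate. -/
def IsMaxCertAssignment {n : ℕ} (𝓖 : Finset (Finset (Fin n)))
    (c : Finset (Fin n) → Finset (Fin n)) : Prop :=
  ∀ F ∈ 𝓖, IsCert 𝓖 F (c F) ∧ ∀ T : Finset (Fin n), IsCert 𝓖 F T → T.card ≤ (c F).card

/-- The shadow `∂𝓗`: all sets obtained from a member of `𝓗` by removing one element. -/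
def shadow' {n : ℕ} (𝓗 : Finset (Finset (Fin n))) : Finset (Finset (Fin n)) :=
  Finset.univ.filter (fun S => ∃ F ∈ 𝓗, S ⊆ F ∧ S.card + 1 = F.card)

/-- `∂̄𝓗 = binom([n], d) \ ∂𝓗`. -/
def compShadow {n : ℕ} (d : ℕ) (𝓗 : Finset (Finset (Fin n))) : Finset (Finset (Fin n)) :=
  Finset.powersetCard d (Finset.univ : Finset (Fin n)) \ shadow' 𝓗

/-- The sets of size `r` having `T` as an inclusion-maximal certificate are minimal covers of the
link of `T`, so boundedly many of them contain a given `W ⊇ T`. -/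
lemma card_filter_superset_le {n r : ℕ} {𝓕 𝓒 : Finset (Finset (Fin n))} {T : Finset (Fin n)}
    (hr : ∀ F ∈ 𝓕, F.card = r) (hsub : 𝓒 ⊆ 𝓕)
    (hcert : ∀ F ∈ 𝓒, IsCert 𝓕 F T)
    (hmin : ∀ F ∈ 𝓒, ∀ x ∈ F \ T, ∃ F' ∈ 𝓕, F' ∩ F = insert x T) (k : ℕ) :
    ∀ W : Finset (Fin n), T ⊆ W → W.card + k = r → (𝓒.filter (W ⊆ ·)).card ≤ r ^ k := by
  induction k with
  | zero =>
    intro W _ hW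
    rw [pow_zero, Finset.card_le_one]
    have key : ∀ F ∈ 𝓒.filter (W ⊆ ·), W = F := by
      intro F hF
      rw [mem_filter] at hF
      exact eq_of_subset_of_card_le hF.2 (by rw [hr F (hsub hF.1)]; omega)
    intro F hF G hG
    rw [← key F hF, ← key G hG]
  | succ k ih =>
    intro W hTW hW
    rcases (𝓒.filter (W ⊆ ·)).eq_empty_or_nonempty with h | ⟨F, hF⟩
    · simp [h]
    rw [mem_filter] at hF
    obtain ⟨x, hxF, hxW⟩ : ∃ x ∈ F, x ∉ W := by
      by_contra! hcon
      have := card_le_card hcon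
      rw [hr F (hsub hF.1)] at this
      omega
    obtain ⟨F', hF', hinter⟩ := hmin F hF.1 x (mem_sdiff.2 ⟨hxF, fun h => hxW (hTW h)⟩)
    have hTF' : T ⊆ F' := fun t ht =>
      (mem_inter.1 (hinter.symm ▸ mem_insert_of_mem ht : t ∈ F' ∩ F)).1
    have hF'W : ∀ y ∈ F', y ∈ W → y ∈ T := by
      intro y hy hyW
      have : y ∈ insert x T := hinter ▸ mem_inter.2 ⟨hy, hF.2 hyW⟩
      rcases mem_insert.1 this with rfl | h
      · exact absurd hyW hxW
      · exact h
    have hcover : 𝓒.filter (W ⊆ ·) ⊆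
        (F' \ W).biUnion fun y => 𝓒.filter (insert y W ⊆ ·) := by
      intro G hG
      rw [mem_filter] at hG
      obtain ⟨hTG, hG'⟩ := hcert G hG.1
      have hne := hG' F' hF'
      obtain ⟨y, hy, hyT⟩ : ∃ y ∈ F' ∩ G, y ∉ T := by
        by_contra! hcon
        exact hne (Subset.antisymm hcon (subset_inter hTF' hTG.1))
      rw [mem_inter] at hy
      rw [mem_biUnion]
      exact ⟨y, mem_sdiff.2 ⟨hy.1, fun h => hyT (hF'W y hy.1 h)⟩,
        mem_filter.2 ⟨hG.1, insert_subset hy.2 hG.2⟩⟩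
    calc (𝓒.filter (W ⊆ ·)).card ≤ _ := card_le_card hcover
      _ ≤ (F' \ W).card * r ^ k := by
        refine card_biUnion_le_card_mul _ _ _ fun y hy => ih _ (hTW.trans (subset_insert _ _)) ?_
        rw [card_insert_of_notMem (mem_sdiff.1 hy).2]
        omega
      _ ≤ r * r ^ k := Nat.mul_le_mul_right _ ((card_le_card sdiff_subset).trans (hr F' hF').le)
      _ = r ^ (k + 1) := (pow_succ' r k).symm

/-- A set is the maximum certificate of boundedly many members. -/
lemma card_filter_maxCert_eq_le {n d : ℕ} {𝓕 : Finset (Finset (Fin n))}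
    {c : Finset (Fin n) → Finset (Fin n)} (hd : ∀ F ∈ 𝓕, F.card = d + 1)
    (hc : IsMaxCertAssignment 𝓕 c) (T : Finset (Fin n)) :
    (𝓕.filter (c · = T)).card ≤ (d + 1) ^ (d + 1) := by
  rcases (𝓕.filter (c · = T)).eq_empty_or_nonempty with h | ⟨F₀, hF₀⟩
  · simp [h]
  have hcert : ∀ F ∈ 𝓕.filter (c · = T), IsCert 𝓕 F T := by
    intro F hF
    rw [mem_filter] at hF
    exact hF.2 ▸ (hc F hF.1).1
  have hmin : ∀ F ∈ 𝓕.filter (c · = T), ∀ x ∈ F \ T, ∃ F' ∈ 𝓕, F' ∩ F = insert x T := by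
    intro F hF x hx
    have hTF := (hcert F hF).1
    rw [mem_filter] at hF
    rw [mem_sdiff] at hx
    have hsub : insert x T ⊆ F := insert_subset hx.1 hTF.1
    by_cases heq : insert x T = F
    · exact ⟨F, hF.1, by rw [inter_self, heq]⟩
    by_contra! hcon
    have := (hc F hF.1).2 (insert x T) ⟨hsub.ssubset_of_ne heq, hcon⟩
    rw [hF.2, card_insert_of_notMem hx.2] at this
    omega
  have hT : T.card ≤ d + 1 := by
    have := card_le_card (hcert F₀ hF₀).1.1
    rwa [hd F₀ (mem_filter.1 hF₀).1] at this
  have h := card_filter_superset_le hd (filter_subset _ _) hcert hmin (d + 1 - T.card) T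
    Subset.rfl (by omega)
  have hall : (𝓕.filter (c · = T)).filter (T ⊆ ·) = 𝓕.filter (c · = T) :=
    filter_true_of_mem fun F hF => (hcert F hF).1.1
  rw [hall] at h
  exact h.trans (Nat.pow_le_pow_right (by omega) (by omega))

/-- The number of sets of size less than `d - 1` is `O(n ^ (d - 2))`. -/
lemma card_filter_card_add_one_lt_le {n : ℕ} (hn : 1 ≤ n) (d : ℕ) :
    ((univ : Finset (Finset (Fin n))).filter (·.card + 1 < d)).card ≤ d * n ^ (d - 2) := by
  have hsub : (univ : Finset (Finset (Fin n))).filter (·.card + 1 < d) ⊆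
      (range (d - 1)).biUnion fun k => powersetCard k univ := by
    intro T hT
    rw [mem_filter] at hT
    rw [mem_biUnion]
    exact ⟨T.card, mem_range.2 (by omega), mem_powersetCard.2 ⟨subset_univ _, rfl⟩⟩
  calc _ ≤ _ := card_le_card hsub
    _ ≤ (range (d - 1)).card * n ^ (d - 2) := by
      refine card_biUnion_le_card_mul _ _ _ fun k hk => ?_
      rw [mem_range] at hk
      rw [card_powersetCard, card_univ, Fintype.card_fin]
      exact (Nat.choose_le_pow n k).trans (Nat.pow_le_pow_right hn (by omega))
    _ ≤ d * n ^ (d - 2) := Nat.mul_le_mul_right _ (by simp)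

/-- If most pairs of elements of `P` produce a member of `M`, boundedly many pairs producing the
same one, then `M` has size quadratic in that of `P`. -/
lemma card_sq_le_of_pairs {α V : Type*} [DecidableEq α] [DecidableEq V] {d D : ℕ} (P : Finset α)
    (a b x y : α → V) (R : Finset V) (M : Finset (Finset V)) (hM : ∀ S ∈ M, S.card = d)
    (hD : ∀ u, (P.filter fun F => a F = u ∨ b F = u).card ≤ D)
    (h : ∀ F ∈ P, ∀ G ∈ P,
      a G ∉ ({a F, b F, x F, y F} : Finset V) → b G ∉ ({a F, b F, x F, y F} : Finset V) →
      a F ∉ ({a G, b G, x G, y G} : Finset V) → b F ∉ ({a G, b G, x G, y G} : Finset V) →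
      ∃ u v, (a F = u ∨ b F = u) ∧ (a G = v ∨ b G = v) ∧ insert u (insert v R) ∈ M) :
    P.card * P.card ≤ 8 * D * P.card + d * d * (D * D) * M.card := by
  let fib : V → Finset α := fun u => P.filter fun F => a F = u ∨ b F = u
  let ent : α → Finset α := fun F =>
    ({a F, b F, x F, y F} : Finset V).biUnion fib
  have hent : ∀ F ∈ P, (ent F).card ≤ 4 * D := fun F _ =>
    (card_biUnion_le_card_mul _ _ _ fun u _ => hD u).trans (Nat.mul_le_mul_right _ card_le_four)
  have mem_ent : ∀ F, ∀ G ∈ P, G ∉ ent F →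
      a G ∉ ({a F, b F, x F, y F} : Finset V) ∧ b G ∉ ({a F, b F, x F, y F} : Finset V) := by
    intro F G hG hGF
    exact ⟨fun h => hGF (mem_biUnion.2 ⟨_, h, mem_filter.2 ⟨hG, .inl rfl⟩⟩),
      fun h => hGF (mem_biUnion.2 ⟨_, h, mem_filter.2 ⟨hG, .inr rfl⟩⟩)⟩
  have hsub : P ×ˢ P ⊆ ((P.biUnion fun F => {F} ×ˢ ent F) ∪ (P.biUnion fun F => ent F ×ˢ {F})) ∪
      M.biUnion fun S => (S ×ˢ S).biUnion fun p => fib p.1 ×ˢ fib p.2 := by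
    rintro ⟨F, G⟩ hFG
    rw [mem_product] at hFG
    obtain ⟨hF, hG⟩ := hFG
    simp only [mem_union, mem_biUnion, mem_product, mem_singleton]
    by_cases h₁ : G ∈ ent F
    · exact .inl (.inl ⟨F, hF, rfl, h₁⟩)
    by_cases h₂ : F ∈ ent G
    · exact .inl (.inr ⟨G, hG, h₂, rfl⟩)
    obtain ⟨h₃, h₄⟩ := mem_ent F G hG h₁
    obtain ⟨h₅, h₆⟩ := mem_ent G F hF h₂
    obtain ⟨u, v, hu, hv, huv⟩ := h F hF G hG h₃ h₄ h₅ h₆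
    exact .inr ⟨_, huv, (u, v), ⟨mem_insert_self _ _, mem_insert_of_mem (mem_insert_self _ _)⟩,
      mem_filter.2 ⟨hF, hu⟩, mem_filter.2 ⟨hG, hv⟩⟩
  have h₁ : (P.biUnion fun F => {F} ×ˢ ent F).card ≤ P.card * (4 * D) :=
    card_biUnion_le_card_mul _ _ _ fun F hF => by simpa using hent F hF
  have h₂ : (P.biUnion fun F => ent F ×ˢ {F}).card ≤ P.card * (4 * D) :=
    card_biUnion_le_card_mul _ _ _ fun F hF => by simpa using hent F hF
  have h₃ : (M.biUnion fun S => (S ×ˢ S).biUnion fun p => fib p.1 ×ˢ fib p.2).card ≤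
      M.card * (d * d * (D * D)) := by
    refine card_biUnion_le_card_mul _ _ _ fun S hS => ?_
    refine (card_biUnion_le_card_mul _ _ (D * D) fun p _ => ?_).trans
      (by rw [card_product, hM S hS])
    rw [card_product]
    exact Nat.mul_le_mul (hD _) (hD _)
  have h₄ := card_le_card hsub
  rw [card_product] at h₄
  have h₅ := card_union_le ((P.biUnion fun F => {F} ×ˢ ent F) ∪ (P.biUnion fun F => ent F ×ˢ {F}))
    (M.biUnion fun S => (S ×ˢ S).biUnion fun p => fib p.1 ×ˢ fib p.2)
  have h₆ := card_union_le (P.biUnion fun F => {F} ×ˢ ent F) (P.biUnion fun F => ent F ×ˢ {F})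
  nlinarith

/-- In the link of `R` in `𝓕`, the pair `{q, z}` covers all sets containing `p`. -/
def LinkCover {n : ℕ} (𝓕 : Finset (Finset (Fin n))) (R : Finset (Fin n)) (p q z : Fin n) : Prop :=
  ∀ E ∈ 𝓕, insert p R ⊆ E → q ∈ E ∨ z ∈ E

lemma IsCert.linkCover {n : ℕ} {𝓕 : Finset (Finset (Fin n))} {R : Finset (Fin n)} {p q z : Fin n}
    (h : IsCert 𝓕 (insert q (insert z (insert p R))) (insert p R)) : LinkCover 𝓕 R p q z := by
  intro E hE hsub
  by_contra! hcon
  refine h.2 E hE ?_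
  rw [inter_insert_of_notMem hcon.1, inter_insert_of_notMem hcon.2, inter_eq_right.2 hsub]

lemma LinkCover.eq_of_subset {n : ℕ} {𝓕 : Finset (Finset (Fin n))} {R : Finset (Fin n)}
    {p q z p' q' z' : Fin n} (h : LinkCover 𝓕 R p q z) (h' : LinkCover 𝓕 R p' q' z')
    (hp : p ∉ R) (hq : q ∉ R) (hz : z ∉ R) (hp' : p' ∉ R) (hq' : q' ∉ R) (hz' : z' ∉ R)
    (hpp' : p ≠ p') (hqp : q ≠ p) (hzp : z ≠ p) (hqp' : q' ≠ p') (hzp' : z' ≠ p')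
    (hp'q : p' ≠ q) (hp'z : p' ≠ z) (hpq' : p ≠ q') (hpz' : p ≠ z')
    (hqq' : q ≠ q') (hqz' : q ≠ z') (hzq' : z ≠ q')
    {E : Finset (Fin n)} (hE : E ∈ 𝓕) (hsub : insert p (insert p' R) ⊆ E)
    (hcard : E.card = R.card + 3) : z = z' := by
  have hunique : ∀ v w, v ∈ E → w ∈ E → v ∉ insert p (insert p' R) →
      w ∉ insert p (insert p' R) → v = w := by
    intro v w hv hw hv' hw'
    by_contra hne
    have := card_le_card (insert_subset hv (insert_subset hw hsub))
    rw [card_insert_of_notMem (by simp_all), card_insert_of_notMem hw',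
      card_insert_of_notMem (by simp_all), card_insert_of_notMem hp'] at this
    omega
  have h₁ := h E hE (fun t ht => hsub (by simp only [mem_insert] at ht ⊢; tauto))
  have h₂ := h' E hE (fun t ht => hsub (by simp only [mem_insert] at ht ⊢; tauto))
  have hq₁ : q ∉ insert p (insert p' R) := by simp [hqp, hp'q.symm, hq]
  have hz₁ : z ∉ insert p (insert p' R) := by simp [hzp, hp'z.symm, hz]
  have hq₂ : q' ∉ insert p (insert p' R) := by simp [hqp', hpq'.symm, hq']
  have hz₂ : z' ∉ insert p (insert p' R) := by simp [hzp', hpz'.symm, hz']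
  rcases h₁ with h₁ | h₁ <;> rcases h₂ with h₂ | h₂
  · exact absurd (hunique _ _ h₁ h₂ hq₁ hq₂) hqq'
  · exact absurd (hunique _ _ h₁ h₂ hq₁ hz₂) hqz'
  · exact absurd (hunique _ _ h₁ h₂ hz₁ hq₂) hzq'
  · exact hunique _ _ h₁ h₂ hz₁ hz₂

/-- `F` and `F'` have distinct certificates of size `d - 1` contained in a common `d`-set that is
contained in both of them. -/
def Conflict {n : ℕ} (d : ℕ) (c : Finset (Fin n) → Finset (Fin n)) (F F' : Finset (Fin n)) : Prop :=
  (c F).card + 1 = d ∧ (c F').card + 1 = d ∧ c F ≠ c F' ∧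
    ∃ S, c F ⊆ S ∧ S ⊆ F ∧ c F' ⊆ S ∧ S ⊆ F' ∧ S.card = d

/-- Coordinates for a conflict between `F` and `F'`. -/
structure ConflictData {n : ℕ} (d : ℕ) (c : Finset (Fin n) → Finset (Fin n))
    (F F' R : Finset (Fin n)) (a b x y : Fin n) : Prop where
  card_R : R.card + 2 = d
  a_notMem : a ∉ R
  b_notMem : b ∉ R
  x_notMem : x ∉ R
  y_notMem : y ∉ R
  a_ne_b : a ≠ b
  a_ne_x : a ≠ x
  b_ne_x : b ≠ x
  a_ne_y : a ≠ y
  b_ne_y : b ≠ y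
  x_ne_y : x ≠ y
  c_left : c F = insert b R
  c_right : c F' = insert a R
  left : F = insert a (insert x (insert b R))
  right : F' = insert b (insert y (insert a R))

lemma Conflict.exists_data {n d : ℕ} {c : Finset (Fin n) → Finset (Fin n)} {F F' : Finset (Fin n)}
    (h : Conflict d c F F') (hF : F.card = d + 1) (hF' : F'.card = d + 1) :
    ∃ R a b x y, ConflictData d c F F' R a b x y := by
  obtain ⟨h₁, h₂, hne, S, hcS, hSF, hcS', hSF', hS⟩ := h
  have exists_insert : ∀ A B : Finset (Fin n), A ⊆ B → A.card + 1 = B.card →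
      ∃ t, t ∉ A ∧ insert t A = B := by
    intro A B hAB hcard
    obtain ⟨t, ht⟩ : ∃ t, B \ A = {t} := by
      rw [← card_eq_one, card_sdiff_of_subset hAB]
      omega
    have htB : t ∈ B \ A := ht ▸ mem_singleton_self t
    rw [mem_sdiff] at htB
    exact ⟨t, htB.2, eq_of_subset_of_card_le (insert_subset htB.1 hAB)
      (by rw [card_insert_of_notMem htB.2]; omega)⟩
  obtain ⟨a, ha, haS⟩ := exists_insert (c F) S hcS (by omega)
  obtain ⟨b, hb, hbS⟩ := exists_insert (c F') S hcS' (by omega)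
  obtain ⟨x, hx, hxF⟩ := exists_insert S F hSF (by omega)
  obtain ⟨y, hy, hyG⟩ := exists_insert S F' hSF' (by omega)
  have hab : a ≠ b := by
    rintro rfl
    refine hne ?_
    rw [← erase_insert ha, haS, ← hbS, erase_insert hb]
  have haS' : a ∈ S := haS ▸ mem_insert_self _ _
  have hbS' : b ∈ S := hbS ▸ mem_insert_self _ _
  have hcF : c F = S.erase a := by rw [← haS, erase_insert ha]
  have hcF' : c F' = S.erase b := by rw [← hbS, erase_insert hb]
  have hbR : insert b ((S.erase a).erase b) = S.erase a :=
    insert_erase (mem_erase.2 ⟨hab.symm, hbS'⟩)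
  have haR : insert a ((S.erase a).erase b) = S.erase b := by
    rw [erase_right_comm]
    exact insert_erase (mem_erase.2 ⟨hab, haS'⟩)
  refine ⟨(S.erase a).erase b, a, b, x, y, ?_, by simp, by simp, by simp [hx], by simp [hy], hab,
    by rintro rfl; exact hx haS', by rintro rfl; exact hx hbS', by rintro rfl; exact hy haS',
    by rintro rfl; exact hy hbS', ?_, by rw [hcF, hbR], by rw [hcF', haR], ?_, ?_⟩
  · have hbE : b ∈ S.erase a := mem_erase.2 ⟨hab.symm, hbS'⟩
    have e₁ := card_erase_add_one hbE
    have e₂ := card_erase_add_one haS'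
    omega
  · rintro rfl
    exact hne (by rw [← hxF.symm.trans hyG] )
  · rw [hbR, insert_comm, insert_erase haS', hxF]
  · rw [haR, insert_comm, insert_erase hbS', hyG]

/-- Two conflicts over the same `R` without coincidences between their vertices produce a `d`-set
outside the shadow. -/
lemma ConflictData.exists_mem_compShadow {n d : ℕ} {𝓕 : Finset (Finset (Fin n))}
    {c : Finset (Fin n) → Finset (Fin n)} (hd : ∀ F ∈ 𝓕, F.card = d + 1)
    (hc : IsMaxCertAssignment 𝓕 c) {F F' G G' R : Finset (Fin n)} {a b x y a' b' x' y' : Fin n}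
    (h : ConflictData d c F F' R a b x y) (h' : ConflictData d c G G' R a' b' x' y')
    (hF : F ∈ 𝓕) (hF' : F' ∈ 𝓕) (hG : G ∈ 𝓕)
    (h₁ : a' ∉ ({a, b, x, y} : Finset (Fin n))) (h₂ : b' ∉ ({a, b, x, y} : Finset (Fin n)))
    (h₃ : a ∉ ({a', b', x', y'} : Finset (Fin n))) (h₄ : b ∉ ({a', b', x', y'} : Finset (Fin n))) :
    ∃ u v, (a = u ∨ b = u) ∧ (a' = v ∨ b' = v) ∧ insert u (insert v R) ∈ compShadow d 𝓕 := by
  simp only [mem_insert, mem_singleton, not_or] at h₁ h₂ h₃ h₄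
  have covF : LinkCover 𝓕 R b a x := by
    have := (hc F hF).1
    rw [h.c_left, h.left] at this
    exact this.linkCover
  have covF' : LinkCover 𝓕 R a b y := by
    have := (hc F' hF').1
    rw [h.c_right, h.right] at this
    exact this.linkCover
  have covG : LinkCover 𝓕 R b' a' x' := by
    have := (hc G hG).1
    rw [h'.c_left, h'.left] at this
    exact this.linkCover
  by_contra! hcon
  have covered : ∀ u v, (a = u ∨ b = u) → (a' = v ∨ b' = v) →
      ∃ E ∈ 𝓕, insert u (insert v R) ⊆ E ∧ E.card = R.card + 3 := by
    intro u v hu hv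
    have hmem := hcon u v hu hv
    have huv : u ∉ insert v R := by
      have := h.a_notMem
      have := h.b_notMem
      rw [mem_insert]
      grind
    have hvR : v ∉ R := by
      have := h'.a_notMem
      have := h'.b_notMem
      grind
    have hcardR := h.card_R
    have hcard : (insert u (insert v R)).card = d := by
      rw [card_insert_of_notMem huv, card_insert_of_notMem hvR]
      omega
    rw [compShadow, mem_sdiff, mem_powersetCard, not_and, not_not] at hmem
    have hsh := hmem ⟨subset_univ _, hcard⟩
    rw [shadow', mem_filter] at hsh
    obtain ⟨-, E, hE, hsub, -⟩ := hsh
    exact ⟨E, hE, hsub, by rw [hd E hE]; omega⟩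
  obtain ⟨a_R, b_R, x_R, y_R, hab, hax, hbx, hay, hby, hxy⟩ := And.intro h.a_notMem <|
    And.intro h.b_notMem <| And.intro h.x_notMem <| And.intro h.y_notMem <| And.intro h.a_ne_b <|
    And.intro h.a_ne_x <| And.intro h.b_ne_x <| And.intro h.a_ne_y <| And.intro h.b_ne_y h.x_ne_y
  obtain ⟨a_R', b_R', x_R', y_R', hab', hax', hbx', hay', hby'⟩ := And.intro h'.a_notMem <|
    And.intro h'.b_notMem <| And.intro h'.x_notMem <| And.intro h'.y_notMem <|
    And.intro h'.a_ne_b <| And.intro h'.a_ne_x <| And.intro h'.b_ne_x <|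
    And.intro h'.a_ne_y h'.b_ne_y
  obtain ⟨h₁a, h₁b, h₁x, h₁y⟩ := h₁
  obtain ⟨h₂a, h₂b, h₂x, h₂y⟩ := h₂
  obtain ⟨h₃a, h₃b, h₃x, h₃y⟩ := h₃
  obtain ⟨h₄a, h₄b, h₄x, h₄y⟩ := h₄
  obtain ⟨E₁, hE₁, hs₁, hk₁⟩ := covered b b' (.inr rfl) (.inr rfl)
  obtain ⟨E₂, hE₂, hs₂, hk₂⟩ := covered a b' (.inl rfl) (.inr rfl)
  have e₁ : x = x' := by
    apply covF.eq_of_subset covG (hE := hE₁) (hsub := hs₁) (hcard := hk₁) <;>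
      first | assumption | (apply Ne.symm; assumption)
  have e₂ : y = x' := by
    apply covF'.eq_of_subset covG (hE := hE₂) (hsub := hs₂) (hcard := hk₂) <;>
      first | assumption | (apply Ne.symm; assumption)
  exact hxy (e₁.trans e₂.symm)

/-- The number of members involved in conflicts is at most `ε |∂̄𝓕| + O(n ^ (d - 2))`, with
`ε = 2 ^ d / N`. -/
lemma exists_card_conflict_le (d N : ℕ) : ∃ A : ℕ, ∀ n : ℕ, 1 ≤ n →
    ∀ (𝓕 P : Finset (Finset (Fin n))) (c : Finset (Fin n) → Finset (Fin n)),
      (∀ F ∈ 𝓕, F.card = d + 1) → IsMaxCertAssignment 𝓕 c → P ⊆ 𝓕 →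
      (∀ F ∈ P, ∃ F' ∈ 𝓕, Conflict d c F F') →
      N * P.card ≤ 2 ^ d * (compShadow d 𝓕).card + A * n ^ (d - 2) := by
  set K := (d + 1) ^ (d + 1) with hK
  set D := K * ((d + 1) * K) + K with hD
  set Q := d * d * (D * D) with hQ
  refine ⟨d * (N * (8 * D + Q * N)), fun n hn 𝓕 P c hd hc hP hconf => ?_⟩
  have hdata : ∀ F ∈ P, ∃ F' R a b x y, F' ∈ 𝓕 ∧ ConflictData d c F F' R a b x y := by
    intro F hF
    obtain ⟨F', hF', h⟩ := hconf F hF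
    obtain ⟨R, a, b, x, y, h⟩ := h.exists_data (hd F (hP hF)) (hd F' hF')
    exact ⟨F', R, a, b, x, y, hF', h⟩
  have : Nonempty (Fin n) := ⟨⟨0, hn⟩⟩
  choose! F' R a b x y hF' h using hdata
  have hPsub : ∀ R₀ : Finset (Fin n), N * (P.filter (R · = R₀)).card ≤
      ((compShadow d 𝓕).filter (R₀ ⊆ ·)).card + N * (8 * D + Q * N) := by
    intro R₀
    have hfib : ∀ u, ((P.filter (R · = R₀)).filter fun F => a F = u ∨ b F = u).card ≤ D := by
      intro u
      have hsub : ((P.filter (R · = R₀)).filter fun F => a F = u ∨ b F = u) ⊆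
          ((𝓕.filter (c · = insert u R₀)).biUnion fun G => G.biUnion fun v =>
            𝓕.filter (c · = insert v R₀)) ∪ 𝓕.filter (c · = insert u R₀) := by
        intro F hF
        simp only [mem_filter] at hF
        obtain ⟨⟨hFP, rfl⟩, hu⟩ := hF
        have hF := h F hFP
        simp only [mem_union, mem_biUnion, mem_filter]
        rcases hu with rfl | rfl
        · refine .inl ⟨F' F, ⟨hF' F hFP, hF.c_right⟩, b F, ?_, hP hFP, hF.c_left⟩
          rw [hF.right]
          exact mem_insert_self _ _
        · exact .inr ⟨hP hFP, hF.c_left⟩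
      refine (card_le_card hsub).trans ((card_union_le _ _).trans (Nat.add_le_add ?_ ?_))
      · refine (card_biUnion_le_card_mul _ _ ((d + 1) * K) fun G hG => ?_).trans
          (Nat.mul_le_mul_right _ (card_filter_maxCert_eq_le hd hc _))
        exact (card_biUnion_le_card_mul _ _ K fun v _ => card_filter_maxCert_eq_le hd hc _).trans
          (by rw [hd G (mem_filter.1 hG).1])
      · exact card_filter_maxCert_eq_le hd hc _
    have hsq := card_sq_le_of_pairs (d := d) (P.filter (R · = R₀)) a b x y R₀
      ((compShadow d 𝓕).filter (R₀ ⊆ ·))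
      (fun S hS => (mem_powersetCard.1 (mem_sdiff.1 (mem_filter.1 hS).1).1).2) hfib (by
        intro F hF G hG h₁ h₂ h₃ h₄
        rw [mem_filter] at hF hG
        obtain ⟨hFP, rfl⟩ := hF
        have hG' := h G hG.1
        rw [hG.2] at hG'
        obtain ⟨u, v, hu, hv, huv⟩ := (h F hFP).exists_mem_compShadow hd hc hG' (hP hFP)
          (hF' F hFP) (hP hG.1) h₁ h₂ h₃ h₄
        exact ⟨u, v, hu, hv, mem_filter.2
          ⟨huv, (subset_insert _ _).trans (subset_insert _ _)⟩⟩)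
    rw [← hQ] at hsq
    set m := (P.filter (R · = R₀)).card
    set s := ((compShadow d 𝓕).filter (R₀ ⊆ ·)).card
    rcases le_total m (8 * D + Q * N) with hm | hm
    · exact (Nat.mul_le_mul_left _ hm).trans (Nat.le_add_left _ _)
    · have hle : Q * (N * m) ≤ Q * s := by nlinarith
      rcases Nat.eq_zero_or_pos Q with hQ0 | hQ0
      · have hm0 : m ≤ 8 * D + Q * N := by
          rw [hQ0] at hsq ⊢
          by_contra! hlt
          nlinarith
        exact (Nat.mul_le_mul_left _ hm0).trans (Nat.le_add_left _ _)
      · exact (Nat.le_of_mul_le_mul_left hle hQ0).trans (Nat.le_add_right _ _)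
  set 𝓣 := (univ : Finset (Finset (Fin n))).filter (·.card + 1 < d) with h𝓣
  have hsum : P.card = ∑ R₀ ∈ 𝓣, (P.filter (R · = R₀)).card := by
    refine card_eq_sum_card_fiberwise fun F hF => ?_
    have := (h F hF).card_R
    exact mem_coe.2 (mem_filter.2 ⟨mem_univ _, by omega⟩)
  have hdouble : ∑ R₀ ∈ 𝓣, ((compShadow d 𝓕).filter (R₀ ⊆ ·)).card ≤
      2 ^ d * (compShadow d 𝓕).card := by
    have := sum_card_bipartiteAbove_eq_sum_card_bipartiteBelow (s := 𝓣) (t := compShadow d 𝓕)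
      (fun R₀ S : Finset (Fin n) => R₀ ⊆ S)
    simp only [bipartiteAbove, bipartiteBelow] at this
    rw [this, mul_comm]
    refine sum_le_card_nsmul _ _ _ fun S hS => ?_
    have hS' : S.card = d := (mem_powersetCard.1 (mem_sdiff.1 hS).1).2
    rw [← hS', ← card_powerset]
    exact card_le_card fun T hT => mem_powerset.2 (mem_filter.1 hT).2
  calc N * P.card = ∑ R₀ ∈ 𝓣, N * (P.filter (R · = R₀)).card := by rw [hsum, mul_sum]
    _ ≤ ∑ R₀ ∈ 𝓣, (((compShadow d 𝓕).filter (R₀ ⊆ ·)).card + N * (8 * D + Q * N)) :=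
      sum_le_sum fun R₀ _ => hPsub R₀
    _ = ∑ R₀ ∈ 𝓣, ((compShadow d 𝓕).filter (R₀ ⊆ ·)).card + 𝓣.card * (N * (8 * D + Q * N)) := by
      rw [sum_add_distrib, sum_const, smul_eq_mul]
    _ ≤ 2 ^ d * (compShadow d 𝓕).card + d * n ^ (d - 2) * (N * (8 * D + Q * N)) :=
      Nat.add_le_add hdouble (Nat.mul_le_mul_right _ (card_filter_card_add_one_lt_le hn d))
    _ = _ := by ring

/-- A family without shattered members has an assignment of maximum certificates. -/
lemma VCDimLE.exists_isMaxCertAssignment {n d : ℕ} {𝓕 : Finset (Finset (Fin n))}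
    (hd : ∀ F ∈ 𝓕, F.card = d + 1) (hVC : VCDimLE 𝓕 d) : ∃ c, IsMaxCertAssignment 𝓕 c := by
  classical
  have hex : ∀ F ∈ 𝓕, ∃ T, IsCert 𝓕 F T ∧ ∀ T', IsCert 𝓕 F T' → T'.card ≤ T.card := by
    intro F hF
    have hns : ¬ Shatters' 𝓕 F := fun hs => by
      have := hVC F hs
      rw [hd F hF] at this
      omega
    simp only [Shatters', not_forall] at hns
    obtain ⟨T, hTF, hT⟩ := hns
    push Not at hT
    have hcert : IsCert 𝓕 F T := ⟨hTF.ssubset_of_ne fun h => hT F hF (by rw [inter_self, h]), hT⟩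
    obtain ⟨T₀, hT₀, hmax⟩ := exists_max_image (univ.filter (IsCert 𝓕 F)) card
      ⟨T, mem_filter.2 ⟨mem_univ _, hcert⟩⟩
    exact ⟨T₀, (mem_filter.1 hT₀).2, fun T' hT' => hmax T' (mem_filter.2 ⟨mem_univ _, hT'⟩)⟩
  choose! c hc using hex
  exact ⟨c, hc⟩

theorem stmt8 (d : ℕ) (hd : 1 ≤ d) :
    ∃ C : ℝ, ∀ n : ℕ, 1 ≤ n → ∀ 𝓕 : Finset (Finset (Fin n)),
      (∀ F ∈ 𝓕, F.card = d + 1) → VCDimLE 𝓕 d →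
      ∃ 𝓖 : Finset (Finset (Fin n)), 𝓖 ⊆ 𝓕 ∧
        ∃ c : Finset (Fin n) → Finset (Fin n), IsMaxCertAssignment 𝓖 c ∧
          -- (i)
          (((𝓕 \ 𝓖).card : ℝ) ≤ 0.1 * ((compShadow d 𝓕).card : ℝ) + C * n ^ (d - 2)) ∧
          ((𝓖.card : ℝ) ≥ (𝓕.card : ℝ) - 0.1 * ((compShadow d 𝓖).card : ℝ) - C * n ^ (d - 2)) ∧
          -- (ii)
          (∀ F ∈ 𝓖, d - 1 ≤ (c F).card ∧ (c F).card ≤ d) ∧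
          -- (iii)
          (∀ F ∈ 𝓖, ∀ F' ∈ 𝓖, (c F).card = d - 1 → (c F').card = d - 1 → c F ≠ c F' →
            Disjoint
              ((Finset.univ : Finset (Finset (Fin n))).filter
                (fun S => c F ⊆ S ∧ S ⊆ F ∧ (S.card = d - 1 ∨ S.card = d)))
              ((Finset.univ : Finset (Finset (Fin n))).filter
                (fun S => c F' ⊆ S ∧ S ⊆ F' ∧ (S.card = d - 1 ∨ S.card = d)))) := by
  classical
  obtain ⟨A, hA⟩ := exists_card_conflict_le d (10 * 2 ^ d)
  refine ⟨((A + d * (d + 1) ^ (d + 1) : ℕ) : ℝ), fun n hn 𝓕 hF hVC => ?_⟩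
  obtain ⟨c₀, hc₀⟩ := hVC.exists_isMaxCertAssignment hF
  set 𝓑 := 𝓕.filter fun F => (c₀ F).card + 1 < d with h𝓑
  set P := 𝓕.filter fun F => ∃ F' ∈ 𝓕, Conflict d c₀ F F' with hP
  set 𝓖 := 𝓕 \ (𝓑 ∪ P) with h𝓖
  have hsub : 𝓖 ⊆ 𝓕 := sdiff_subset
  have hcertmono : ∀ F T, IsCert 𝓕 F T → IsCert 𝓖 F T := fun F T h =>
    ⟨h.1, fun F' hF' => h.2 F' (hsub hF')⟩
  have hVC' : VCDimLE 𝓖 d := fun S hS => hVC S fun B hB => by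
    obtain ⟨F, hF, h⟩ := hS B hB
    exact ⟨F, hsub hF, h⟩
  obtain ⟨c₁, hc₁⟩ := hVC'.exists_isMaxCertAssignment fun F h => hF F (hsub h)
  let c : Finset (Fin n) → Finset (Fin n) := fun F =>
    if (c₁ F).card ≤ (c₀ F).card then c₀ F else c₁ F
  have hc : IsMaxCertAssignment 𝓖 c := by
    intro F hFG
    by_cases hle : (c₁ F).card ≤ (c₀ F).card
    · simp only [c, if_pos hle]
      exact ⟨hcertmono _ _ (hc₀ F (hsub hFG)).1, fun T hT => ((hc₁ F hFG).2 T hT).trans hle⟩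
    · simp only [c, if_neg hle]
      exact hc₁ F hFG
  have hlower : ∀ F ∈ 𝓖, d ≤ (c₀ F).card + 1 := by
    intro F hFG
    rw [h𝓖, mem_sdiff, mem_union, not_or, h𝓑, mem_filter] at hFG
    by_contra! hlt
    exact hFG.2.1 ⟨hFG.1, hlt⟩
  have hge : ∀ F ∈ 𝓖, (c₀ F).card ≤ (c F).card := fun F hFG =>
    (hc F hFG).2 _ (hcertmono _ _ (hc₀ F (hsub hFG)).1)
  have heq : ∀ F ∈ 𝓖, (c F).card = d - 1 → c F = c₀ F := by
    intro F hFG hcard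
    by_cases hle : (c₁ F).card ≤ (c₀ F).card
    · simp only [c, if_pos hle]
    · simp only [c, if_neg hle] at hcard
      have := hlower F hFG
      omega
  have h𝓑card : 𝓑.card ≤ d * (d + 1) ^ (d + 1) * n ^ (d - 2) := by
    have hcover : 𝓑 ⊆ ((univ : Finset (Finset (Fin n))).filter (·.card + 1 < d)).biUnion
        fun T => 𝓕.filter (c₀ · = T) := by
      intro F h
      rw [h𝓑, mem_filter] at h
      exact mem_biUnion.2 ⟨c₀ F, mem_filter.2 ⟨mem_univ _, h.2⟩, mem_filter.2 ⟨h.1, rfl⟩⟩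
    calc 𝓑.card ≤ _ := card_le_card hcover
      _ ≤ _ * (d + 1) ^ (d + 1) :=
        card_biUnion_le_card_mul _ _ _ fun T _ => card_filter_maxCert_eq_le hF hc₀ T
      _ ≤ d * n ^ (d - 2) * (d + 1) ^ (d + 1) :=
        Nat.mul_le_mul_right _ (card_filter_card_add_one_lt_le hn d)
      _ = _ := by ring
  have hPcard : 10 * P.card ≤ (compShadow d 𝓕).card + A * n ^ (d - 2) := by
    have := hA n hn 𝓕 P c₀ hF hc₀ (filter_subset _ _) fun F h => (mem_filter.1 h).2
    have hpow : 0 < 2 ^ d := by positivity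
    refine le_of_mul_le_mul_left ?_ hpow
    have : A * n ^ (d - 2) ≤ 2 ^ d * (A * n ^ (d - 2)) := Nat.le_mul_of_pos_left _ hpow
    linarith
  have hdiff : ((𝓕 \ 𝓖).card : ℝ) ≤ 0.1 * ((compShadow d 𝓕).card : ℝ) +
      ((A + d * (d + 1) ^ (d + 1) : ℕ) : ℝ) * n ^ (d - 2) := by
    have h₁ : (𝓕 \ 𝓖).card ≤ 𝓑.card + P.card := by
      refine (card_le_card ?_).trans (card_union_le _ _)
      rw [h𝓖, sdiff_sdiff_right_self]
      exact inter_subset_right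
    have h₂ : 10 * (𝓕 \ 𝓖).card ≤ (compShadow d 𝓕).card + A * n ^ (d - 2) +
        10 * (d * (d + 1) ^ (d + 1) * n ^ (d - 2)) := by linarith
    have h₃ : (10 : ℝ) * (𝓕 \ 𝓖).card ≤ (compShadow d 𝓕).card + A * n ^ (d - 2) +
        10 * (d * (d + 1) ^ (d + 1) * n ^ (d - 2)) := by exact_mod_cast h₂
    have h₄ : (0 : ℝ) ≤ A * n ^ (d - 2) := by positivity
    push_cast
    linarith
  refine ⟨𝓖, hsub, c, hc, hdiff, ?_, ?_, ?_⟩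
  · have hcard : ((𝓕 \ 𝓖).card : ℝ) + 𝓖.card = 𝓕.card := by
      exact_mod_cast card_sdiff_add_card_eq_card hsub
    have hmono : ((compShadow d 𝓕).card : ℝ) ≤ (compShadow d 𝓖).card := by
      refine Nat.cast_le.2 (card_le_card (sdiff_subset_sdiff Subset.rfl fun S hS => ?_))
      rw [shadow', mem_filter] at hS ⊢
      obtain ⟨-, F, hFG, h⟩ := hS
      exact ⟨mem_univ _, F, hsub hFG, h⟩
    linarith
  · intro F hFG
    have h₁ := hlower F hFG
    have h₂ := hge F hFG
    have h₃ := card_lt_card (hc F hFG).1.1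
    rw [hF F (hsub hFG)] at h₃
    omega
  · intro F hFG F' hFG' hcard hcard' hne
    have hF₀ := heq F hFG hcard
    have hF₀' := heq F' hFG' hcard'
    rw [hF₀] at hcard hne ⊢
    rw [hF₀'] at hcard' hne ⊢
    rw [disjoint_left]
    intro S hS hS'
    rw [mem_filter] at hS hS'
    obtain ⟨-, h₁, h₂, h₃⟩ := hS
    obtain ⟨-, h₁', h₂', -⟩ := hS'
    rcases h₃ with h₃ | h₃
    · exact hne ((eq_of_subset_of_card_le h₁ (by omega)).trans
        (eq_of_subset_of_card_le h₁' (by omega)).symm)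
    · have hmem := hFG
      rw [h𝓖, mem_sdiff, mem_union, not_or] at hmem
      exact hmem.2.2 (mem_filter.2 ⟨hmem.1, F', hsub hFG', by omega, by omega, hne, S, h₁, h₂,
        h₁', h₂', h₃⟩)
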